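/- Let k ≥ 1, let F = GaloisField 2 (2k), let α ∈ F, and let i ≥ 0 be an integer. Then the Boolean function F_α^i : F → ZMod 2 defined by F_α^i(x) = Tr(α x^{2^i} (x + x^{2^k})) is bent if and only if α does not lie in the subfield F_{2^k}, i.e., if and only if α^{2^k} ≠ α. -/

import Mathlib

open Finset

noncomputable instance (n : ℕ) : Fintype (GaloisField 2 n) := Fintype.ofFinite _

/-- The absolute trace of `GaloisField 2 n` over `ZMod 2`. -/
noncomputable def gTr (n : ℕ) : GaloisField 2 n → ZMod 2 :=
  Algebra.trace (ZMod 2) (GaloisField 2 n)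

/-- A Boolean function on `GaloisField 2 n` is bent if all its Walsh values
square to `2^n`. -/
def IsBent {n : ℕ} (f : GaloisField 2 n → ZMod 2) : Prop :=
  ∀ lam : GaloisField 2 n,
    (∑ x : GaloisField 2 n, (-1 : ℤ) ^ (f x + gTr n (lam * x)).val) ^ 2 = 2 ^ n

theorem gTr_add (n : ℕ) (x y : GaloisField 2 n) : gTr n (x + y) = gTr n x + gTr n y :=
  map_add (Algebra.trace (ZMod 2) (GaloisField 2 n)) x y

theorem gTr_pow_two_pow (n j : ℕ) (x : GaloisField 2 n) : gTr n (x ^ 2 ^ j) = gTr n x := by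
  induction j with
  | zero => simp
  | succ j ih =>
    rw [pow_succ 2 j, pow_mul, ← ih]
    have h := Algebra.trace_eq_of_algEquiv
      (FiniteField.frobeniusAlgEquivOfAlgebraic (ZMod 2) (GaloisField 2 n)) (x ^ 2 ^ j)
    simpa [gTr, ZMod.card] using h

theorem exists_gTr_mul_ne_zero {n : ℕ} {a : GaloisField 2 n} (ha : a ≠ 0) :
    ∃ b, gTr n (a * b) ≠ 0 := by
  by_contra! h
  exact ha ((traceForm_nondegenerate (ZMod 2) (GaloisField 2 n)).1 a h)

theorem neg_one_pow_val_add (a b : ZMod 2) :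
    (-1 : ℤ) ^ (a + b).val = (-1) ^ a.val * (-1) ^ b.val := by
  revert a b; decide

theorem neg_one_pow_val_of_ne_zero {a : ZMod 2} (ha : a ≠ 0) : (-1 : ℤ) ^ a.val = -1 := by
  revert a; decide

/-- A sign sum vanishes as soon as some translation flips every sign. -/
theorem sum_neg_one_pow_val_eq_zero {G : Type*} [AddGroup G] [Fintype G] (g : G → ZMod 2)
    (t : G) {c : ZMod 2} (hc : c ≠ 0) (h : ∀ x, g (x + t) = g x + c) :
    ∑ x, (-1 : ℤ) ^ (g x).val = 0 := by
  have h1 := Equiv.sum_comp (Equiv.addRight t) fun x => (-1 : ℤ) ^ (g x).val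
  simp only [Equiv.coe_addRight, h, neg_one_pow_val_add, neg_one_pow_val_of_ne_zero hc,
    mul_neg_one, sum_neg_distrib] at h1
  lia

/-- A function whose polar form `B` is additive in the first variable and nondegenerate has
sign sum of square `|G|`. -/
theorem sq_sum_neg_one_pow_val_eq_card {G : Type*} [AddCommGroup G] [Fintype G]
    (g : G → ZMod 2) (B : G → G → ZMod 2) (hg : ∀ x y, g (x + y) = g x + g y + B x y)
    (hadd : ∀ x x' y, B (x + x') y = B x y + B x' y)
    (hnd : ∀ y, y ≠ 0 → ∃ t, B t y ≠ 0) :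
    (∑ x, (-1 : ℤ) ^ (g x).val) ^ 2 = Fintype.card G := by
  classical
  have hprod : ∀ x y, (-1 : ℤ) ^ (g x).val * (-1) ^ (g (x + y)).val =
      (-1) ^ (g y + B x y).val := by
    intro x y
    rw [hg, ← neg_one_pow_val_add, add_assoc, ← add_assoc, CharTwo.add_self_eq_zero, zero_add]
  have hcard : ∑ x : G, (-1 : ℤ) ^ (g 0 + B x 0).val = Fintype.card G := by
    simp [← hprod, ← mul_pow]
  rw [sq, sum_mul_sum]
  calc ∑ x, ∑ y, (-1 : ℤ) ^ (g x).val * (-1) ^ (g y).val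
      = ∑ x, ∑ y, (-1 : ℤ) ^ (g y + B x y).val := by
        refine sum_congr rfl fun x _ => ?_
        simp only [← hprod]
        exact (Equiv.sum_comp (Equiv.addLeft x)
          fun y => (-1 : ℤ) ^ (g x).val * (-1) ^ (g y).val).symm
    _ = ∑ y, ∑ x, (-1 : ℤ) ^ (g y + B x y).val := sum_comm
    _ = ∑ x, (-1 : ℤ) ^ (g 0 + B x 0).val := by
        refine sum_eq_single 0 (fun y _ hy => ?_) (by simp)
        obtain ⟨t, ht⟩ := hnd y hy
        exact sum_neg_one_pow_val_eq_zero _ t ht fun x => by rw [hadd, add_assoc]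
    _ = Fintype.card G := hcard

theorem pow_two_pow_pow_two_pow (k : ℕ) (hk : 1 ≤ k) (x : GaloisField 2 (2 * k)) :
    (x ^ 2 ^ k) ^ 2 ^ k = x := by
  have h := FiniteField.pow_card x
  rw [Fintype.card_eq_nat_card, GaloisField.card 2 _ (by lia)] at h
  rw [← pow_mul, ← pow_add, ← two_mul, h]

/-- If `α` lies outside the subfield, the polar form of `x ↦ Tr (α x^{2^i} (x + x^{2^k}))`
is nondegenerate. -/
theorem exists_polar_ne_zero (k : ℕ) (hk : 1 ≤ k) {α : GaloisField 2 (2 * k)} (i : ℕ)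
    (hα : α ^ 2 ^ k ≠ α) {y : GaloisField 2 (2 * k)} (hy : y ≠ 0) :
    ∃ t, gTr (2 * k) (α * t ^ 2 ^ i * (y + y ^ 2 ^ k) + α * y ^ 2 ^ i * (t + t ^ 2 ^ k)) ≠ 0 := by
  have hconj := pow_two_pow_pow_two_pow k hk
  set z := α * y ^ 2 ^ i + (α * y ^ 2 ^ i) ^ 2 ^ k with hz
  set w := y + y ^ 2 ^ k with hw
  have hzc : z ^ 2 ^ k = z := by rw [hz, add_pow_char_pow, hconj, add_comm]
  have hwc : w ^ 2 ^ k = w := by rw [hw, add_pow_char_pow, hconj, add_comm]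
  have hform : ∀ t, gTr (2 * k) (α * t ^ 2 ^ i * w + α * y ^ 2 ^ i * (t + t ^ 2 ^ k)) =
      gTr (2 * k) ((α * w + z ^ 2 ^ i) * t ^ 2 ^ i) := by
    intro t
    have h1 : gTr (2 * k) (α * y ^ 2 ^ i * t ^ 2 ^ k) =
        gTr (2 * k) ((α * y ^ 2 ^ i) ^ 2 ^ k * t) := by
      rw [← gTr_pow_two_pow _ k, mul_pow, hconj]
    rw [gTr_add, mul_add (α * y ^ 2 ^ i), gTr_add _ (α * y ^ 2 ^ i * t), h1, ← gTr_add, ← add_mul, ← hz,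
      ← gTr_pow_two_pow _ i (z * t), mul_pow, ← gTr_add]
    congr 1
    ring
  have hL : α * w + z ^ 2 ^ i ≠ 0 := by
    intro h0
    have h1 : α * w = z ^ 2 ^ i := CharTwo.add_eq_zero.mp h0
    have h2 : α ^ 2 ^ k * w = α * w := by
      rw [← hwc, ← mul_pow, hwc, h1, pow_right_comm, hzc]
    have hw0 : w = 0 := by
      by_contra hne
      exact hα (mul_right_cancel₀ hne h2)
    have hz0 : z = 0 := by
      rw [hw0, mul_zero] at h1
      exact eq_zero_of_pow_eq_zero h1.symm
    have hyc : y ^ 2 ^ k = y := (CharTwo.add_eq_zero.mp hw0).symm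
    rw [hz, CharTwo.add_eq_zero, mul_pow, pow_right_comm y, hyc] at hz0
    exact hα (mul_right_cancel₀ (pow_ne_zero _ hy) hz0).symm
  obtain ⟨b, hb⟩ := exists_gTr_mul_ne_zero hL
  obtain ⟨t, rfl⟩ : ∃ t, t ^ 2 ^ i = b :=
    Finite.surjective_of_injective (iterateFrobenius_inj (GaloisField 2 (2 * k)) 2 i) b
  exact ⟨t, by rwa [hform]⟩

theorem stmt_6 (k : ℕ) (hk : 1 ≤ k) (α : GaloisField 2 (2 * k)) (i : ℕ) :
    IsBent (fun x : GaloisField 2 (2 * k) =>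
      gTr (2 * k) (α * x ^ 2 ^ i * (x + x ^ 2 ^ k))) ↔ α ^ 2 ^ k ≠ α := by
  constructor
  · intro hbent hα
    obtain ⟨lam, hlam⟩ := exists_gTr_mul_ne_zero (one_ne_zero (α := GaloisField 2 (2 * k)))
    rw [one_mul] at hlam
    have h := hbent lam
    rw [sum_neg_one_pow_val_eq_zero _ 1 hlam] at h
    · exact absurd h.symm (by simp)
    · intro x
      have h1 : gTr (2 * k) (α * (x + x ^ 2 ^ k)) = 0 := by
        rw [mul_add, gTr_add, ← gTr_pow_two_pow _ k (α * x), mul_pow, hα,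
          CharTwo.add_self_eq_zero]
      have h2 : α * (x + 1) ^ 2 ^ i * (x + 1 + (x + 1) ^ 2 ^ k) =
          α * x ^ 2 ^ i * (x + x ^ 2 ^ k) + α * (x + x ^ 2 ^ k) := by
        rw [add_pow_char_pow, add_pow_char_pow, one_pow, one_pow, add_add_add_comm,
          CharTwo.add_self_eq_zero, add_zero]
        ring
      beta_reduce
      rw [h2, gTr_add _ _ (α * (x + x ^ 2 ^ k)), h1, add_zero, mul_add lam, mul_one,
        gTr_add _ (lam * x), add_assoc]
  · intro hα lam
    have hcard : (Fintype.card (GaloisField 2 (2 * k)) : ℤ) = 2 ^ (2 * k) := by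
      rw [Fintype.card_eq_nat_card, GaloisField.card 2 _ (by lia)]
      norm_cast
    rw [← hcard]
    refine sq_sum_neg_one_pow_val_eq_card _
      (fun x y => gTr (2 * k) (α * x ^ 2 ^ i * (y + y ^ 2 ^ k) + α * y ^ 2 ^ i * (x + x ^ 2 ^ k)))
      (fun x y => ?_) (fun x x' y => ?_) (fun y hy => exists_polar_ne_zero k hk i hα hy)
    · simp only [← gTr_add, add_pow_char_pow]
      congr 1
      ring
    · simp only [← gTr_add, add_pow_char_pow]
      congr 1
      ring
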